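/- Let T be a tree on vertex set {1,...,n} with edge set E, let H_1,...,H_n be finite-dimensional complex Hilbert spaces, and let σ be any density operator on H_1⊗···⊗H_n. Then Σ_{{i,j}∈E} S(σ_{ij}) − Σ_{i=1}^n (deg(i) − 1) S(σ_i) − S(σ) ≥ 0, where σ_{ij} and σ_i denote the bipartite and single-site marginals of σ and deg(i) is the degree of vertex i in T; indeed this quantity equals a finite sum of quantum conditional mutual informations of σ (each nonnegative by strong subadditivity), obtained by iteratively removing leaves of T. -/

import Mathlib

open scoped Matrix ComplexOrder

/-- Functional calculus for Hermitian matrices: apply `f : ℝ → ℝ` to the eigenvalues. -/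
noncomputable def matFun {n : Type*} [Fintype n] [DecidableEq n]
    (f : ℝ → ℝ) (ρ : Matrix n n ℂ) : Matrix n n ℂ :=
  if h : ρ.IsHermitian then
    (h.eigenvectorUnitary : Matrix n n ℂ) *
      Matrix.diagonal (fun i => (f (h.eigenvalues i) : ℂ)) *
        (star (h.eigenvectorUnitary : Matrix n n ℂ))
  else 0

/-- Matrix logarithm via functional calculus. -/
noncomputable def matLog {n : Type*} [Fintype n] [DecidableEq n] (ρ : Matrix n n ℂ) :
    Matrix n n ℂ := matFun Real.log ρ

/-- A density operator: positive semidefinite with trace one. -/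
def IsDensity {n : Type*} [Fintype n] (ρ : Matrix n n ℂ) : Prop :=
  ρ.PosSemidef ∧ ρ.trace = 1

/-- The von Neumann entropy `S(ρ) = -Tr(ρ log ρ)`, computed via eigenvalues. -/
noncomputable def vnEntropy {n : Type*} [Fintype n] [DecidableEq n] (ρ : Matrix n n ℂ) : ℝ :=
  if h : ρ.IsHermitian then -∑ i, h.eigenvalues i * Real.log (h.eigenvalues i) else 0

/-- The quantum relative entropy `S(ρ‖σ) = Tr[ρ (log ρ - log σ)]`. -/
noncomputable def relEntropy {n : Type*} [Fintype n] [DecidableEq n]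
    (ρ σ : Matrix n n ℂ) : ℝ := ((ρ * (matLog ρ - matLog σ)).trace).re

section Multipartite

variable {n : ℕ} {d : Fin n → ℕ}

/-- The marginal of a multipartite state on the sites in `S`, obtained by tracing out the
complementary sites. -/
noncomputable def marg (S : Finset (Fin n))
    (ρ : Matrix (∀ i, Fin (d i)) (∀ i, Fin (d i)) ℂ) :
    Matrix (∀ i : {j // j ∈ S}, Fin (d i.1)) (∀ i : {j // j ∈ S}, Fin (d i.1)) ℂ :=
  fun x y => ∑ z : ∀ i : {j // j ∉ S}, Fin (d i.1),
    ρ (fun i => if h : i ∈ S then x ⟨i, h⟩ else z ⟨i, h⟩)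
      (fun i => if h : i ∈ S then y ⟨i, h⟩ else z ⟨i, h⟩)

/-- Extend an operator acting on the sites in `S` to the full multipartite space by tensoring
with the identity on the complementary sites. -/
noncomputable def extSub (S : Finset (Fin n))
    (M : Matrix (∀ i : {j // j ∈ S}, Fin (d i.1)) (∀ i : {j // j ∈ S}, Fin (d i.1)) ℂ) :
    Matrix (∀ i, Fin (d i)) (∀ i, Fin (d i)) ℂ :=
  fun x y =>
    M (fun i => x i.1) (fun i => y i.1) *
      (if (fun i : {j // j ∉ S} => x i.1) = (fun i : {j // j ∉ S} => y i.1) then 1 else 0)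

/-- The quantum conditional mutual information `I_ρ(U:W|S)` between the groups of sites
`U` and `W` given the group `S`. -/
noncomputable def qcmiSets (U W S : Finset (Fin n))
    (ρ : Matrix (∀ i, Fin (d i)) (∀ i, Fin (d i)) ℂ) : ℝ :=
  vnEntropy (marg (U ∪ S) ρ) + vnEntropy (marg (W ∪ S) ρ)
    - vnEntropy (marg S ρ) - vnEntropy (marg (U ∪ W ∪ S) ρ)

/-- `S` separates `U` and `W` in the graph `G`: every walk from a vertex of `U` to a vertex of
`W` meets `S`. -/
def SeparatesIn (G : SimpleGraph (Fin n)) (U W S : Finset (Fin n)) : Prop :=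
  ∀ u ∈ U, ∀ w ∈ W, ∀ p : G.Walk u w, ∃ s ∈ S, s ∈ p.support

/-- The global Markov property of a multipartite state with respect to a graph `G`: whenever
disjoint groups of sites `U` and `W` are separated by `S` in `G`, `I_ρ(U:W|S) = 0`. -/
def GlobalMarkov (G : SimpleGraph (Fin n))
    (ρ : Matrix (∀ i, Fin (d i)) (∀ i, Fin (d i)) ℂ) : Prop :=
  ∀ U W S : Finset (Fin n), Disjoint U W → Disjoint U S → Disjoint W S →
    SeparatesIn G U W S → qcmiSets U W S ρ = 0

/-- The edges of a graph on `Fin n`, as ordered pairs `(i, j)` with `i < j`. -/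
noncomputable def edgePairs (G : SimpleGraph (Fin n)) [DecidableRel G.Adj] :
    Finset (Fin n × Fin n) :=
  Finset.univ.filter (fun p : Fin n × Fin n => p.1 < p.2 ∧ G.Adj p.1 p.2)

end Multipartite


lemma aux_tr {n : Type*} [Fintype n] [DecidableEq n] (U V Y : Matrix n n ℂ)
    (hU : Uᴴ * U = 1) (hV : Vᴴ * V = 1) (p s : n → ℝ) :
    ((V * Y * Uᴴ)ᴴ * (U * Matrix.diagonal (fun i => (p i : ℂ)) * Uᴴ)).trace.re
      = ∑ j, ∑ i, (star (Y j i) * (Vᴴ * U) j i).re * p i ∧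
    ((V * Y * Uᴴ)ᴴ * (V * Y * Uᴴ) * (U * Matrix.diagonal (fun i => (p i : ℂ)) * Uᴴ)).trace.re
      = ∑ j, ∑ i, ‖Y j i‖ ^ 2 * p i ∧
    ((V * Y * Uᴴ) * (V * Y * Uᴴ)ᴴ * (V * Matrix.diagonal (fun i => (s i : ℂ)) * Vᴴ)).trace.re
      = ∑ j, ∑ i, ‖Y j i‖ ^ 2 * s j := by
  have hU2 : ∀ Z : Matrix n n ℂ, Uᴴ * (U * Z) = Z := fun Z => by
    rw [← Matrix.mul_assoc, hU, Matrix.one_mul]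
  have hV2 : ∀ Z : Matrix n n ℂ, Vᴴ * (V * Z) = Z := fun Z => by
    rw [← Matrix.mul_assoc, hV, Matrix.one_mul]
  have key : ∀ z : ℂ, (star z * z).re = ‖z‖ ^ 2 := fun z => by
    rw [Complex.star_def, ← Complex.normSq_eq_conj_mul_self, Complex.ofReal_re,
      Complex.normSq_eq_norm_sq]
  refine ⟨?_, ?_, ?_⟩
  · have : ((V * Y * Uᴴ)ᴴ * (U * Matrix.diagonal (fun i => (p i : ℂ)) * Uᴴ)).trace
        = (Yᴴ * ((Vᴴ * U) * Matrix.diagonal (fun i => (p i : ℂ)))).trace := by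
      simp only [Matrix.conjTranspose_mul, Matrix.conjTranspose_conjTranspose, Matrix.mul_assoc]
      rw [Matrix.trace_mul_comm]
      simp only [Matrix.mul_assoc, hU, Matrix.mul_one]
    rw [this]
    simp only [Matrix.trace, Matrix.diag, Matrix.mul_apply (M := Yᴴ), Matrix.mul_diagonal,
      Matrix.conjTranspose_apply, Complex.re_sum]
    rw [Finset.sum_comm]
    refine Finset.sum_congr rfl fun j _ => Finset.sum_congr rfl fun i _ => ?_
    rw [← mul_assoc, Complex.re_mul_ofReal]
  · have : ((V * Y * Uᴴ)ᴴ * (V * Y * Uᴴ) * (U * Matrix.diagonal (fun i => (p i : ℂ)) * Uᴴ)).trace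
        = (Yᴴ * (Y * Matrix.diagonal (fun i => (p i : ℂ)))).trace := by
      simp only [Matrix.conjTranspose_mul, Matrix.conjTranspose_conjTranspose, Matrix.mul_assoc,
        hU2, hV2]
      rw [Matrix.trace_mul_comm]
      simp only [Matrix.mul_assoc, hU, Matrix.mul_one]
    rw [this]
    simp only [Matrix.trace, Matrix.diag, Matrix.mul_apply (M := Yᴴ), Matrix.mul_diagonal,
      Matrix.conjTranspose_apply, Complex.re_sum]
    rw [Finset.sum_comm]
    refine Finset.sum_congr rfl fun j _ => Finset.sum_congr rfl fun i _ => ?_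
    rw [← mul_assoc, Complex.re_mul_ofReal, key]
  · have : ((V * Y * Uᴴ) * (V * Y * Uᴴ)ᴴ * (V * Matrix.diagonal (fun i => (s i : ℂ)) * Vᴴ)).trace
        = (Y * (Yᴴ * Matrix.diagonal (fun i => (s i : ℂ)))).trace := by
      simp only [Matrix.conjTranspose_mul, Matrix.conjTranspose_conjTranspose, Matrix.mul_assoc,
        hU2, hV2]
      rw [Matrix.trace_mul_comm]
      simp only [Matrix.mul_assoc, hV, Matrix.mul_one]
    rw [this]
    simp only [Matrix.trace, Matrix.diag, Matrix.mul_apply (M := Y), Matrix.mul_diagonal,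
      Matrix.conjTranspose_apply, Complex.re_sum]
    refine Finset.sum_congr rfl fun j _ => Finset.sum_congr rfl fun i _ => ?_
    rw [← mul_assoc, Complex.re_mul_ofReal, mul_comm (Y j i), key]

/-- scalar completion of the square -/
lemma aux_sq (y w : ℂ) (p c : ℝ) (hc : 0 < c) :
    2 * ((star y * w).re * p) - c * ‖y‖ ^ 2 ≤ ‖w‖ ^ 2 * (p ^ 2 / c) := by
  have h1 : (star y * w).re * p ≤ ‖y‖ * (‖w‖ * |p|) := by
    calc _ ≤ |(star y * w).re * p| := le_abs_self _
      _ = |(star y * w).re| * |p| := abs_mul _ _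
      _ ≤ ‖star y * w‖ * |p| := by gcongr; exact Complex.abs_re_le_norm _
      _ = _ := by rw [norm_mul, norm_star]; ring
  have h2 : ‖w‖ ^ 2 * (p ^ 2 / c) = (‖w‖ * |p|) ^ 2 / c := by
    rw [mul_pow, sq_abs]; ring
  rw [h2, le_div_iff₀ hc]
  nlinarith [sq_nonneg (c * ‖y‖ - ‖w‖ * |p|), mul_le_mul_of_nonneg_left h1 hc.le]

lemma aux_sq_eq (w : ℂ) (p c : ℝ) (hc : 0 < c) :
    2 * ((star (((p / c : ℝ) : ℂ) * w) * w).re * p) - c * ‖((p / c : ℝ) : ℂ) * w‖ ^ 2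
      = ‖w‖ ^ 2 * (p ^ 2 / c) := by
  have : (star (((p / c : ℝ) : ℂ) * w) * w).re = (p / c) * ‖w‖ ^ 2 := by
    rw [star_mul', Complex.star_def, Complex.conj_ofReal, mul_assoc,
      Complex.re_ofReal_mul, ← Complex.normSq_eq_conj_mul_self, Complex.ofReal_re,
      Complex.normSq_eq_norm_sq]
  rw [this, norm_mul, Complex.norm_real, Real.norm_eq_abs, mul_pow, sq_abs]
  field_simp
  ring

/-- The quadratic form whose supremum is `Q`. -/
lemma Q_mono {m n : Type*} [Fintype n] [DecidableEq n] [Fintype m] [DecidableEq m]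
    (U V : Matrix n n ℂ) (hU : Uᴴ * U = 1) (hV : Vᴴ * V = 1) (p s : n → ℝ)
    (hp : ∀ i, 0 < p i) (hs : ∀ i, 0 < s i)
    (U' V' : Matrix m m ℂ) (hU' : U'ᴴ * U' = 1) (hV' : V'ᴴ * V' = 1) (p' s' : m → ℝ)
    (hp' : ∀ i, 0 < p' i) (hs' : ∀ i, 0 < s' i)
    (Φ : Matrix m m ℂ → Matrix n n ℂ)
    (hΦ1 : ∀ X, (Φ X)ᴴ = Φ Xᴴ) (hΦ2 : ∀ X Y, Φ X * Φ Y = Φ (X * Y))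
    (h1 : ∀ X, (Φ X * (U * Matrix.diagonal (fun i => (p i : ℂ)) * Uᴴ)).trace
      = (X * (U' * Matrix.diagonal (fun i => (p' i : ℂ)) * U'ᴴ)).trace)
    (h2 : ∀ X, (Φ X * (V * Matrix.diagonal (fun i => (s i : ℂ)) * Vᴴ)).trace
      = (X * (V' * Matrix.diagonal (fun i => (s' i : ℂ)) * V'ᴴ)).trace)
    (t : ℝ) (ht : 0 ≤ t) :
    ∑ j, ∑ i, ‖(V'ᴴ * U') j i‖ ^ 2 * (p' i ^ 2 / (s' j + t * p' i)) ≤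
    ∑ j, ∑ i, ‖(Vᴴ * U) j i‖ ^ 2 * (p i ^ 2 / (s j + t * p i)) := by
  set Y' : Matrix m m ℂ := fun j i => ((p' i / (s' j + t * p' i) : ℝ) : ℂ) * (V'ᴴ * U') j i with hY'
  set X' := V' * Y' * U'ᴴ with hX'
  obtain ⟨a1, a2, a3⟩ := aux_tr U' V' Y' hU' hV' p' s'
  set Y := Vᴴ * Φ X' * U with hY
  have hVV : V * Vᴴ = 1 := mul_eq_one_comm.mp hV
  have hUU : U * Uᴴ = 1 := mul_eq_one_comm.mp hU
  have hX : V * Y * Uᴴ = Φ X' := by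
    rw [hY]
    calc _ = (V * Vᴴ) * Φ X' * (U * Uᴴ) := by simp only [Matrix.mul_assoc]
      _ = _ := by rw [hVV, hUU, Matrix.one_mul, Matrix.mul_one]
  obtain ⟨b1, b2, b3⟩ := aux_tr U V Y hU hV p s
  rw [hX, hΦ1] at b1 b2 b3
  rw [hΦ2] at b2 b3
  rw [h1] at b1 b2
  rw [h2] at b3
  rw [← hX'] at a1 a2 a3
  calc _ = ∑ j, ∑ i, (2 * ((star (Y' j i) * (V'ᴴ * U') j i).re * p' i)
          - (s' j + t * p' i) * ‖Y' j i‖ ^ 2) := by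
        refine Finset.sum_congr rfl fun j _ => Finset.sum_congr rfl fun i _ => ?_
        rw [hY', aux_sq_eq]
        have := hp' i; have := hs' j; positivity
    _ = 2 * (∑ j, ∑ i, (star (Y' j i) * (V'ᴴ * U') j i).re * p' i)
        - (∑ j, ∑ i, ‖Y' j i‖ ^ 2 * s' j) - t * ∑ j, ∑ i, ‖Y' j i‖ ^ 2 * p' i := by
        simp only [Finset.mul_sum, ← Finset.sum_sub_distrib]
        refine Finset.sum_congr rfl fun j _ => Finset.sum_congr rfl fun i _ => ?_
        ring
    _ = 2 * (∑ j, ∑ i, (star (Y j i) * (Vᴴ * U) j i).re * p i)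
        - (∑ j, ∑ i, ‖Y j i‖ ^ 2 * s j) - t * ∑ j, ∑ i, ‖Y j i‖ ^ 2 * p i := by
        rw [← a1, ← a2, ← a3, ← b1, ← b2, ← b3]
    _ = ∑ j, ∑ i, (2 * ((star (Y j i) * (Vᴴ * U) j i).re * p i)
          - (s j + t * p i) * ‖Y j i‖ ^ 2) := by
        simp only [Finset.mul_sum, ← Finset.sum_sub_distrib]
        refine Finset.sum_congr rfl fun j _ => Finset.sum_congr rfl fun i _ => ?_
        ring
    _ ≤ _ := by
        refine Finset.sum_le_sum fun j _ => Finset.sum_le_sum fun i _ => ?_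
        apply aux_sq
        have := hp i; have := hs j; positivity

open Filter Topology in
theorem hder : ∀ {J I : Type*} [Fintype J] [Fintype I] (w : J → I → ℝ) (p : I → ℝ) (s : J → ℝ),
    (∀ i, 0 < p i) → (∀ i, 0 < s i) → ∀ t : ℝ, 0 ≤ t →
    HasDerivAt (fun t => ∑ j, ∑ i, w j i * (p i * Real.log (s j + t * p i)))
      (∑ j, ∑ i, w j i * (p i ^ 2 / (s j + t * p i))) t := by
  intro J I _ _ w p s hp hs t ht
  refine HasDerivAt.fun_sum fun j _ => HasDerivAt.fun_sum fun i _ => ?_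
  have h0 : 0 < s j + t * p i := by have := hp i; have := hs j; positivity
  have h1 : HasDerivAt (fun t => s j + t * p i) (p i) t := by
    simpa using ((hasDerivAt_id t).mul_const (p i)).const_add (s j)
  have h2 := ((h1.log h0.ne').const_mul (p i)).const_mul (w j i)
  rw [sq, mul_div_assoc]
  exact h2

open Filter Topology in
theorem hlim : ∀ {J I : Type*} [Fintype J] [Fintype I] (w : J → I → ℝ) (p : I → ℝ) (s : J → ℝ),
    (∀ i, 0 < p i) → (∀ i, 0 < s i) →
    Tendsto (fun T => (∑ j, ∑ i, w j i * (p i * Real.log (s j + T * p i)))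
        - (∑ j, ∑ i, w j i * (p i * Real.log (s j + 0 * p i)))
        - (∑ j, ∑ i, w j i * p i) * Real.log T) atTop
      (𝓝 (∑ j, ∑ i, w j i * (p i * (Real.log (p i) - Real.log (s j))))) := by
  intro J I _ _ w p s hp hs
  have h1 : Tendsto (fun T : ℝ => ∑ j, ∑ i, w j i * (p i * (Real.log (s j / T + p i)
      - Real.log (s j)))) atTop
      (𝓝 (∑ j, ∑ i, w j i * (p i * (Real.log (p i) - Real.log (s j))))) := by
    refine tendsto_finsetSum _ fun j _ => tendsto_finsetSum _ fun i _ => ?_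
    refine ((Tendsto.sub_const ?_ _).const_mul _).const_mul _
    have h2 : Tendsto (fun T : ℝ => s j / T + p i) atTop (𝓝 (0 + p i)) :=
      (tendsto_const_nhds.div_atTop tendsto_id).add_const _
    rw [zero_add] at h2
    exact h2.log (hp i).ne'
  refine h1.congr' ?_
  filter_upwards [eventually_gt_atTop 0] with T hT
  simp only [Finset.sum_mul, ← Finset.sum_sub_distrib]
  refine Finset.sum_congr rfl fun j _ => Finset.sum_congr rfl fun i _ => ?_
  have h0 : 0 < s j + T * p i := by have := hp i; have := hs j; positivity
  have : s j / T + p i = (s j + T * p i) / T := by field_simp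
  rw [this, Real.log_div h0.ne' hT.ne', zero_mul, add_zero]
  ring

open Filter Topology in
/-- Integrating the family of inequalities in `t` over `[0, ∞)`. -/
lemma log_limit {J I J' I' : Type*} [Fintype J] [Fintype I] [Fintype J'] [Fintype I']
    (w : J → I → ℝ) (p : I → ℝ) (s : J → ℝ) (w' : J' → I' → ℝ) (p' : I' → ℝ) (s' : J' → ℝ)
    (hp : ∀ i, 0 < p i) (hs : ∀ i, 0 < s i) (hp' : ∀ i, 0 < p' i) (hs' : ∀ i, 0 < s' i)
    (hQ : ∀ t : ℝ, 0 ≤ t → ∑ j, ∑ i, w' j i * (p' i ^ 2 / (s' j + t * p' i)) ≤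
      ∑ j, ∑ i, w j i * (p i ^ 2 / (s j + t * p i)))
    (hP : ∑ j, ∑ i, w j i * p i = ∑ j, ∑ i, w' j i * p' i) :
    ∑ j, ∑ i, w' j i * (p' i * (Real.log (p' i) - Real.log (s' j))) ≤
      ∑ j, ∑ i, w j i * (p i * (Real.log (p i) - Real.log (s j))) := by
  refine le_of_tendsto_of_tendsto (hlim w' p' s' hp' hs') (hlim w p s hp hs) ?_
  filter_upwards [eventually_ge_atTop 0] with T hT
  rw [hP]
  have hd : ∀ t : ℝ, 0 ≤ t → HasDerivAt (fun t =>
      (∑ j, ∑ i, w j i * (p i * Real.log (s j + t * p i)))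
      - ∑ j, ∑ i, w' j i * (p' i * Real.log (s' j + t * p' i))) _ t := fun t ht =>
    (hder w p s hp hs t ht).sub (hder w' p' s' hp' hs' t ht)
  have hmono : MonotoneOn (fun t =>
      (∑ j, ∑ i, w j i * (p i * Real.log (s j + t * p i)))
      - ∑ j, ∑ i, w' j i * (p' i * Real.log (s' j + t * p' i))) (Set.Ici 0) := by
    refine monotoneOn_of_deriv_nonneg (convex_Ici 0)
      (fun t ht => (hd t ht).continuousAt.continuousWithinAt) ?_ ?_
    · intro t ht
      rw [interior_Ici] at ht
      exact (hd t (le_of_lt ht)).differentiableAt.differentiableWithinAt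
    · intro t ht
      rw [interior_Ici] at ht
      rw [(hd t (le_of_lt ht)).deriv]
      linarith [hQ t (le_of_lt ht)]
  have := hmono (Set.mem_Ici.mpr le_rfl) (Set.mem_Ici.mpr hT) hT
  simp only at this
  linarith

lemma w_sum {n : Type*} [Fintype n] [DecidableEq n] (U V : Matrix n n ℂ) (p f : n → ℝ) :
    ∑ j, ∑ i, ‖(Vᴴ * U) j i‖ ^ 2 * (p i * f j) =
    ((U * Matrix.diagonal (fun i => (p i : ℂ)) * Uᴴ) *
      (V * Matrix.diagonal (fun i => (f i : ℂ)) * Vᴴ)).trace.re := by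
  have key : ∀ z : ℂ, (star z * z).re = ‖z‖ ^ 2 := fun z => by
    rw [Complex.star_def, ← Complex.normSq_eq_conj_mul_self, Complex.ofReal_re,
      Complex.normSq_eq_norm_sq]
  have h : ((U * Matrix.diagonal (fun i => (p i : ℂ)) * Uᴴ) *
      (V * Matrix.diagonal (fun i => (f i : ℂ)) * Vᴴ)).trace
      = (((Vᴴ * U) * Matrix.diagonal (fun i => (p i : ℂ))) *
        ((Vᴴ * U)ᴴ * Matrix.diagonal (fun i => (f i : ℂ)))).trace := by
    rw [← Matrix.mul_assoc (U * _ * Uᴴ) (V * _) Vᴴ, Matrix.trace_mul_comm]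
    simp only [Matrix.mul_assoc, Matrix.conjTranspose_mul, Matrix.conjTranspose_conjTranspose]
  rw [h]
  simp only [Matrix.trace, Matrix.diag, Matrix.mul_apply (M := (Vᴴ * U) * _), Matrix.mul_diagonal,
      Matrix.conjTranspose_apply, Complex.re_sum]
  refine Finset.sum_congr rfl fun j _ => Finset.sum_congr rfl fun i _ => ?_
  rw [← key]
  have : (Vᴴ * U) j i * (p i : ℂ) * (star ((Vᴴ * U) j i) * (f j : ℂ))
    = (star ((Vᴴ * U) j i) * (Vᴴ * U) j i) * ((p i * f j : ℝ) : ℂ) := by push_cast; ring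
  rw [this, Complex.re_mul_ofReal]

lemma tr_diag {n : Type*} [Fintype n] [DecidableEq n] (U : Matrix n n ℂ) (hU : Uᴴ * U = 1)
    (p f : n → ℝ) :
    ((U * Matrix.diagonal (fun i => (p i : ℂ)) * Uᴴ) *
      (U * Matrix.diagonal (fun i => (f i : ℂ)) * Uᴴ)).trace.re = ∑ i, p i * f i := by
  have : ((U * Matrix.diagonal (fun i => (p i : ℂ)) * Uᴴ) *
      (U * Matrix.diagonal (fun i => (f i : ℂ)) * Uᴴ)) =
      U * (Matrix.diagonal (fun i => (p i : ℂ)) * (Uᴴ * U) *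
        Matrix.diagonal (fun i => (f i : ℂ)) * Uᴴ) := by simp only [Matrix.mul_assoc]
  rw [this, Matrix.trace_mul_comm, Matrix.mul_assoc, hU, Matrix.mul_one, Matrix.mul_one,
    Matrix.diagonal_mul_diagonal, Matrix.trace_diagonal, Complex.re_sum]
  refine Finset.sum_congr rfl fun i _ => ?_
  rw [← Complex.ofReal_mul, Complex.ofReal_re]

theorem hone : ∀ {n : Type*} [Fintype n] [DecidableEq n] (U V : Matrix n n ℂ), Uᴴ * U = 1 →
    Vᴴ * V = 1 → ∀ p : n → ℝ, ∑ j, ∑ i, ‖(Vᴴ * U) j i‖ ^ 2 * p i = ∑ i, p i := by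
  intro n _ _ U V hU hV p
  have a := w_sum U V p (fun _ => 1)
  have b := tr_diag U hU p (fun _ => 1)
  have hVV : V * Vᴴ = 1 := mul_eq_one_comm.mp hV
  have hUU : U * Uᴴ = 1 := mul_eq_one_comm.mp hU
  simp only [Complex.ofReal_one, Matrix.diagonal_one, Matrix.mul_one, hVV, hUU, mul_one] at a b
  rw [a, b]

theorem hre : ∀ {n : Type*} [Fintype n] [DecidableEq n] (U V : Matrix n n ℂ), Uᴴ * U = 1 →
    Vᴴ * V = 1 → ∀ p s : n → ℝ,
    ∑ j, ∑ i, ‖(Vᴴ * U) j i‖ ^ 2 * (p i * (Real.log (p i) - Real.log (s j))) =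
    ∑ i, p i * Real.log (p i) - ((U * Matrix.diagonal (fun i => (p i : ℂ)) * Uᴴ) *
    (V * Matrix.diagonal (fun i => (Real.log (s i) : ℂ)) * Vᴴ)).trace.re := by
  intro n _ _ U V hU hV p s
  rw [← w_sum, ← hone U V hU hV (fun i => p i * Real.log (p i))]
  simp only [← Finset.sum_sub_distrib, mul_sub]

lemma D_mono {m n : Type*} [Fintype n] [DecidableEq n] [Fintype m] [DecidableEq m]
    (U V : Matrix n n ℂ) (hU : Uᴴ * U = 1) (hV : Vᴴ * V = 1) (p s : n → ℝ)
    (hp : ∀ i, 0 < p i) (hs : ∀ i, 0 < s i)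
    (U' V' : Matrix m m ℂ) (hU' : U'ᴴ * U' = 1) (hV' : V'ᴴ * V' = 1) (p' s' : m → ℝ)
    (hp' : ∀ i, 0 < p' i) (hs' : ∀ i, 0 < s' i)
    (Φ : Matrix m m ℂ → Matrix n n ℂ)
    (hΦ0 : Φ 1 = 1)
    (hΦ1 : ∀ X, (Φ X)ᴴ = Φ Xᴴ) (hΦ2 : ∀ X Y, Φ X * Φ Y = Φ (X * Y))
    (h1 : ∀ X, (Φ X * (U * Matrix.diagonal (fun i => (p i : ℂ)) * Uᴴ)).trace
      = (X * (U' * Matrix.diagonal (fun i => (p' i : ℂ)) * U'ᴴ)).trace)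
    (h2 : ∀ X, (Φ X * (V * Matrix.diagonal (fun i => (s i : ℂ)) * Vᴴ)).trace
      = (X * (V' * Matrix.diagonal (fun i => (s' i : ℂ)) * V'ᴴ)).trace) :
    ∑ i, p' i * Real.log (p' i) - ((U' * Matrix.diagonal (fun i => (p' i : ℂ)) * U'ᴴ) *
      (V' * Matrix.diagonal (fun i => (Real.log (s' i) : ℂ)) * V'ᴴ)).trace.re ≤
    ∑ i, p i * Real.log (p i) - ((U * Matrix.diagonal (fun i => (p i : ℂ)) * Uᴴ) *
      (V * Matrix.diagonal (fun i => (Real.log (s i) : ℂ)) * Vᴴ)).trace.re := by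
  rw [← hre U V hU hV, ← hre U' V' hU' hV']
  refine log_limit _ p s _ p' s' hp hs hp' hs' ?_ ?_
  · intro t ht
    exact Q_mono U V hU hV p s hp hs U' V' hU' hV' p' s' hp' hs' Φ hΦ1 hΦ2 h1 h2 t ht
  · rw [hone U V hU hV, hone U' V' hU' hV']
    have a := h1 1
    rw [hΦ0, Matrix.one_mul, Matrix.one_mul] at a
    have b := tr_diag U hU p (fun _ => 1)
    have b' := tr_diag U' hU' p' (fun _ => 1)
    have hUU : U * Uᴴ = 1 := mul_eq_one_comm.mp hU
    have hUU' : U' * U'ᴴ = 1 := mul_eq_one_comm.mp hU'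
    simp only [Complex.ofReal_one, Matrix.diagonal_one, Matrix.mul_one, hUU, hUU', mul_one] at b b'
    rw [← b, ← b', a]

section SSA
open scoped Kronecker
variable {A B C : Type*} [Fintype A] [Fintype B] [Fintype C]
  [DecidableEq A] [DecidableEq B] [DecidableEq C]

lemma tr_kron_one {m : Type*} [Fintype m] [DecidableEq m] (X : Matrix m m ℂ)
    (M : Matrix (m × C) (m × C) ℂ) :
    ((X ⊗ₖ (1 : Matrix C C ℂ)) * M).trace
      = (X * (Matrix.of fun x y => ∑ c, M (x, c) (y, c) : Matrix m m ℂ)).trace := by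
  simp only [Matrix.trace, Matrix.diag, Matrix.mul_apply, Matrix.of_apply, Fintype.sum_prod_type,
    Matrix.kroneckerMap_apply, Matrix.one_apply, mul_ite, ite_mul, mul_one, mul_zero, zero_mul,
    Finset.sum_ite_eq, Finset.mem_univ, if_true, Finset.mul_sum]
  refine Finset.sum_congr rfl fun i _ => ?_
  rw [Finset.sum_comm]

lemma tr_one_kron {m : Type*} [Fintype m] [DecidableEq m] (X : Matrix m m ℂ)
    (M : Matrix (A × m) (A × m) ℂ) :
    (M * ((1 : Matrix A A ℂ) ⊗ₖ X)).trace
      = ((Matrix.of fun x y => ∑ a, M (a, x) (a, y) : Matrix m m ℂ) * X).trace := by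
  simp only [Matrix.trace, Matrix.diag, Matrix.mul_apply, Matrix.of_apply, Fintype.sum_prod_type,
    Matrix.kroneckerMap_apply, Matrix.one_apply, mul_ite, ite_mul, one_mul, mul_zero, zero_mul,
    Finset.sum_ite_irrel, Finset.sum_const_zero,
    Finset.sum_ite_eq', Finset.mem_univ, if_true, Finset.sum_mul]
  rw [Finset.sum_comm]
  refine Finset.sum_congr rfl fun i _ => ?_
  rw [Finset.sum_comm]

lemma one_kron_diag {m : Type*} [Fintype m] [DecidableEq m] (V : Matrix m m ℂ) (s : m → ℂ) :
    ((1 : Matrix A A ℂ) ⊗ₖ V) * Matrix.diagonal (fun i : A × m => s i.2) *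
      ((1 : Matrix A A ℂ) ⊗ₖ V)ᴴ = (1 : Matrix A A ℂ) ⊗ₖ (V * Matrix.diagonal s * Vᴴ) := by
  have : Matrix.diagonal (fun i : A × m => s i.2)
      = (1 : Matrix A A ℂ) ⊗ₖ Matrix.diagonal s := by
    rw [← Matrix.diagonal_one, Matrix.diagonal_kronecker_diagonal]; simp
  rw [this, Matrix.conjTranspose_kronecker, ← Matrix.mul_kronecker_mul,
    ← Matrix.mul_kronecker_mul, Matrix.conjTranspose_one, Matrix.one_mul, Matrix.one_mul]

lemma trace_submatrix_equiv' {m n : Type*} [Fintype m] [Fintype n] (e : m ≃ n)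
    (M : Matrix n n ℂ) : (M.submatrix e e).trace = M.trace := by
  simp only [Matrix.trace, Matrix.diag, Matrix.submatrix_apply]
  exact Equiv.sum_comp e (fun i => M i i)

lemma shift_diag {n : Type*} [Fintype n] [DecidableEq n] (U : Matrix n n ℂ) (hU : Uᴴ * U = 1)
    (p : n → ℝ) (r : ℝ) : U * Matrix.diagonal (fun i => ((p i + r : ℝ) : ℂ)) * Uᴴ =
        U * Matrix.diagonal (fun i => (p i : ℂ)) * Uᴴ + (r : ℂ) • 1 := by
  have hUU : U * Uᴴ = 1 := mul_eq_one_comm.mp hU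
  have : Matrix.diagonal (fun i => ((p i + r : ℝ) : ℂ))
      = Matrix.diagonal (fun i => (p i : ℂ)) + (r : ℂ) • 1 := by
    rw [Matrix.smul_one_eq_diagonal, Matrix.diagonal_add]; simp
  rw [this, Matrix.mul_add, Matrix.add_mul, Matrix.mul_smul, Matrix.smul_mul, Matrix.mul_one, hUU]

open Filter Topology in
lemma lim_ent {n : Type*} [Fintype n] (p : n → ℝ) (k : ℝ) :
    Tendsto (fun ε : ℝ => ∑ i, (p i + ε * k) * Real.log (p i + ε * k)) (𝓝[>] 0)
        (𝓝 (∑ i, p i * Real.log (p i))) := by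
  have hc : Continuous (fun ε : ℝ => ∑ i, (p i + ε * k) * Real.log (p i + ε * k)) :=
    continuous_finsetSum _ fun i _ => Real.continuous_mul_log.comp (by fun_prop)
  have := (hc.tendsto 0).mono_left (nhdsWithin_le_nhds (s := Set.Ioi 0))
  simpa using this

/-- Strong subadditivity for positive definite operators, in terms of diagonalizations. -/
lemma ssa_posdef (ρ : Matrix ((A × B) × C) ((A × B) × C) ℂ)
    (U : Matrix ((A × B) × C) ((A × B) × C) ℂ) (hU : Uᴴ * U = 1) (p : (A × B) × C → ℝ)
    (hp : ∀ i, 0 < p i) (hρ : ρ = U * Matrix.diagonal (fun i => (p i : ℂ)) * Uᴴ)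
    (V : Matrix (B × C) (B × C) ℂ) (hV : Vᴴ * V = 1) (s : B × C → ℝ) (hs : ∀ i, 0 < s i)
    (hBC : (Matrix.of fun x y => ∑ a, ρ ((a, x.1), x.2) ((a, y.1), y.2) : Matrix (B × C) (B × C) ℂ)
      = V * Matrix.diagonal (fun i => (s i : ℂ)) * Vᴴ)
    (U' : Matrix (A × B) (A × B) ℂ) (hU' : U'ᴴ * U' = 1) (p' : A × B → ℝ)
    (hp' : ∀ i, 0 < p' i)
    (hAB : (Matrix.of fun x y => ∑ c, ρ (x, c) (y, c) : Matrix (A × B) (A × B) ℂ)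
      = U' * Matrix.diagonal (fun i => (p' i : ℂ)) * U'ᴴ)
    (V' : Matrix B B ℂ) (hV' : V'ᴴ * V' = 1) (s' : B → ℝ) (hs' : ∀ i, 0 < s' i)
    (hB : (Matrix.of fun x y => ∑ a, ∑ c, ρ ((a, x), c) ((a, y), c) : Matrix B B ℂ)
      = V' * Matrix.diagonal (fun i => (s' i : ℂ)) * V'ᴴ) :
    ∑ i, p' i * Real.log (p' i) - ∑ i, s' i * Real.log (s' i) ≤
    ∑ i, p i * Real.log (p i) - ∑ i, s i * Real.log (s i) := by
  let e := Equiv.prodAssoc A B C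
  let V1 : Matrix ((A × B) × C) ((A × B) × C) ℂ := ((1 : Matrix A A ℂ) ⊗ₖ V).submatrix e e
  let V2 : Matrix (A × B) (A × B) ℂ := (1 : Matrix A A ℂ) ⊗ₖ V'
  have hV1 : V1ᴴ * V1 = 1 := by
    simp only [V1, Matrix.conjTranspose_submatrix, Matrix.submatrix_mul_equiv,
      Matrix.conjTranspose_kronecker, ← Matrix.mul_kronecker_mul, hV, Matrix.conjTranspose_one,
      Matrix.one_mul, Matrix.one_kronecker_one, Matrix.submatrix_one_equiv]
  have hV2 : V2ᴴ * V2 = 1 := by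
    simp only [V2, 
      Matrix.conjTranspose_kronecker, ← Matrix.mul_kronecker_mul, hV', Matrix.conjTranspose_one,
      Matrix.one_mul, Matrix.one_kronecker_one]
  have hV1d : ∀ f : B × C → ℝ, V1 * Matrix.diagonal (fun i => (f (e i).2 : ℂ)) * V1ᴴ =
      ((1 : Matrix A A ℂ) ⊗ₖ (V * Matrix.diagonal (fun i => (f i : ℂ)) * Vᴴ)).submatrix e e := by
    intro f
    have : Matrix.diagonal (fun i => (f (e i).2 : ℂ)) =
      (Matrix.diagonal (fun i : A × B × C => (f i.2 : ℂ))).submatrix e e := by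
      rw [Matrix.submatrix_diagonal_equiv]; rfl
    rw [this]
    simp only [V1, Matrix.conjTranspose_submatrix, Matrix.submatrix_mul_equiv]
    rw [one_kron_diag V (fun i => (f i : ℂ))]
  have hV2d : ∀ f : B → ℝ, V2 * Matrix.diagonal (fun i => (f i.2 : ℂ)) * V2ᴴ =
      ((1 : Matrix A A ℂ) ⊗ₖ (V' * Matrix.diagonal (fun i => (f i : ℂ)) * V'ᴴ)) := by
    intro f
    exact one_kron_diag V' (fun i => (f i : ℂ))
  have main := D_mono U V1 hU hV1 p (fun i => s (e i).2) hp (fun i => hs _)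
    U' V2 hU' hV2 p' (fun i => s' i.2) hp' (fun i => hs' _) (fun X => X ⊗ₖ (1 : Matrix C C ℂ))
    Matrix.one_kronecker_one
    (fun X => by rw [Matrix.conjTranspose_kronecker, Matrix.conjTranspose_one])
    (fun X Y => by rw [← Matrix.mul_kronecker_mul, Matrix.one_mul])
    (fun X => by rw [tr_kron_one, ← hρ, hAB])
    (fun X => by
      rw [tr_kron_one, hV1d, hV2d, ← hBC, ← hB]
      congr 2
      ext x y
      simp only [Matrix.of_apply, Matrix.submatrix_apply, Matrix.kroneckerMap_apply, e, Equiv.prodAssoc_apply]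
      refine (Finset.mul_sum Finset.univ (fun c => ∑ a, ρ ((a, x.2), c) ((a, y.2), c))
        ((1 : Matrix A A ℂ) x.1 y.1)).symm.trans ?_
      rw [Finset.sum_comm])
  have e1 := hV1d (fun i => Real.log (s i))
  have e2 := hV2d (fun i => Real.log (s' i))
  rw [e1, e2, ← hρ, ← hAB] at main
  have t2 : ((Matrix.of fun x y => ∑ c, ρ (x, c) (y, c) : Matrix (A × B) (A × B) ℂ) *
      ((1 : Matrix A A ℂ) ⊗ₖ (V' * Matrix.diagonal (fun i => (Real.log (s' i) : ℂ)) * V'ᴴ))).trace.re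
      = ∑ i, s' i * Real.log (s' i) := by
    rw [tr_one_kron, ← tr_diag V' hV', ← hB]
    rfl
  have t1 : (ρ * ((1 : Matrix A A ℂ) ⊗ₖ
      (V * Matrix.diagonal (fun i => (Real.log (s i) : ℂ)) * Vᴴ)).submatrix e e).trace.re
      = ∑ i, s i * Real.log (s i) := by
    have hr : ρ = (ρ.submatrix e.symm e.symm).submatrix e e := by
      simp
    rw [hr, Matrix.submatrix_mul_equiv, trace_submatrix_equiv', tr_one_kron,
      ← tr_diag V hV, ← hBC]
    rfl
  rw [t1, t2] at main
  exact main

open Filter Topology in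
/-- Strong subadditivity for positive semidefinite operators, in terms of diagonalizations. -/
lemma ssa_psd (ρ : Matrix ((A × B) × C) ((A × B) × C) ℂ) [Nonempty A] [Nonempty C]
    (U : Matrix ((A × B) × C) ((A × B) × C) ℂ) (hU : Uᴴ * U = 1) (p : (A × B) × C → ℝ)
    (hp : ∀ i, 0 ≤ p i) (hρ : ρ = U * Matrix.diagonal (fun i => (p i : ℂ)) * Uᴴ)
    (V : Matrix (B × C) (B × C) ℂ) (hV : Vᴴ * V = 1) (s : B × C → ℝ) (hs : ∀ i, 0 ≤ s i)
    (hBC : (Matrix.of fun x y => ∑ a, ρ ((a, x.1), x.2) ((a, y.1), y.2) : Matrix (B × C) (B × C) ℂ)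
      = V * Matrix.diagonal (fun i => (s i : ℂ)) * Vᴴ)
    (U' : Matrix (A × B) (A × B) ℂ) (hU' : U'ᴴ * U' = 1) (p' : A × B → ℝ)
    (hp' : ∀ i, 0 ≤ p' i)
    (hAB : (Matrix.of fun x y => ∑ c, ρ (x, c) (y, c) : Matrix (A × B) (A × B) ℂ)
      = U' * Matrix.diagonal (fun i => (p' i : ℂ)) * U'ᴴ)
    (V' : Matrix B B ℂ) (hV' : V'ᴴ * V' = 1) (s' : B → ℝ) (hs' : ∀ i, 0 ≤ s' i)
    (hB : (Matrix.of fun x y => ∑ a, ∑ c, ρ ((a, x), c) ((a, y), c) : Matrix B B ℂ)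
      = V' * Matrix.diagonal (fun i => (s' i : ℂ)) * V'ᴴ) :
    ∑ i, p' i * Real.log (p' i) - ∑ i, s' i * Real.log (s' i) ≤
    ∑ i, p i * Real.log (p i) - ∑ i, s i * Real.log (s i) := by
  have hA : (0 : ℝ) < Fintype.card A := by exact_mod_cast Fintype.card_pos
  have hC : (0 : ℝ) < Fintype.card C := by exact_mod_cast Fintype.card_pos
  refine le_of_tendsto_of_tendsto
    ((lim_ent p' (Fintype.card C)).sub (lim_ent s' (Fintype.card A * Fintype.card C)))
    ((lim_ent p 1).sub (lim_ent s (Fintype.card A))) ?_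
  filter_upwards [self_mem_nhdsWithin] with ε (hε : 0 < ε)
  refine ssa_posdef (ρ + ((ε * 1 : ℝ) : ℂ) • 1) U hU _ (fun i => ?_) ?_ V hV _ (fun i => ?_) ?_
    U' hU' _ (fun i => ?_) ?_ V' hV' _ (fun i => ?_) ?_
  · have := hp i; positivity
  · rw [shift_diag U hU, hρ]
  · have := hs i; positivity
  · rw [shift_diag V hV, ← hBC]
    ext x y
    by_cases h : x = y
    · subst h; simp [Finset.sum_add_distrib, mul_comm]
    · simp [Matrix.one_apply, h, Finset.sum_add_distrib]
      exact fun h1 h2 => absurd (Prod.ext h1 h2) h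
  · have := hp' i; positivity
  · rw [shift_diag U' hU', ← hAB]
    ext x y
    by_cases h : x = y
    · subst h; simp [Finset.sum_add_distrib, mul_comm]
    · simp [Matrix.one_apply, h, Finset.sum_add_distrib]
  · have := hs' i; positivity
  · rw [shift_diag V' hV', ← hB]
    ext x y
    by_cases h : x = y
    · subst h; simp [Finset.sum_add_distrib]; ring
    · simp [Matrix.one_apply, h, Finset.sum_add_distrib]

lemma psd_diag {n : Type*} [Fintype n] [DecidableEq n] (M : Matrix n n ℂ) (hM : M.PosSemidef) :
    ∃ (U : Matrix n n ℂ) (p : n → ℝ), Uᴴ * U = 1 ∧ (∀ i, 0 ≤ p i) ∧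
      M = U * Matrix.diagonal (fun i => (p i : ℂ)) * Uᴴ ∧
      vnEntropy M = - ∑ i, p i * Real.log (p i) := by
  refine ⟨hM.isHermitian.eigenvectorUnitary, hM.isHermitian.eigenvalues, ?_, ?_, ?_, ?_⟩
  · exact Unitary.coe_star_mul_self hM.isHermitian.eigenvectorUnitary
  · exact hM.eigenvalues_nonneg
  · have := hM.isHermitian.spectral_theorem
    rw [Unitary.conjStarAlgAut_apply] at this
    exact this
  · rw [vnEntropy, dif_pos hM.isHermitian]

lemma psd_sum {m n z : Type*} [Fintype z] (M : Matrix n n ℂ) (hM : M.PosSemidef)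
    (f : z → m → n) : (Matrix.of fun x y => ∑ c, M (f c x) (f c y) : Matrix m m ℂ).PosSemidef := by
  have : (Matrix.of fun x y => ∑ c, M (f c x) (f c y) : Matrix m m ℂ)
      = ∑ c, M.submatrix (f c) (f c) := by
    ext x y; simp [Matrix.sum_apply]
  rw [this]
  exact Matrix.posSemidef_sum _ fun c _ => hM.submatrix _

lemma ssa_entropy (ρ : Matrix ((A × B) × C) ((A × B) × C) ℂ) [Nonempty A] [Nonempty C]
    (hρ : ρ.PosSemidef) :
    vnEntropy ρ + vnEntropy (Matrix.of fun x y => ∑ a, ∑ c, ρ ((a, x), c) ((a, y), c) : Matrix B B ℂ)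
    ≤ vnEntropy (Matrix.of fun x y => ∑ c, ρ (x, c) (y, c) : Matrix (A × B) (A × B) ℂ) +
      vnEntropy (Matrix.of fun x y => ∑ a, ρ ((a, x.1), x.2) ((a, y.1), y.2) :
        Matrix (B × C) (B × C) ℂ) := by
  have hB : (Matrix.of fun x y => ∑ a, ∑ c, ρ ((a, x), c) ((a, y), c) : Matrix B B ℂ).PosSemidef := by
    have := psd_sum ρ hρ (fun (z : A × C) (x : B) => ((z.1, x), z.2))
    simpa only [Fintype.sum_prod_type] using this
  obtain ⟨U, p, hU, hp, h1, e1⟩ := psd_diag ρ hρ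
  obtain ⟨V, s, hV, hs, h2, e2⟩ := psd_diag _
    (psd_sum ρ hρ (fun (a : A) (x : B × C) => ((a, x.1), x.2)))
  obtain ⟨U', p', hU', hp', h3, e3⟩ := psd_diag _
    (psd_sum ρ hρ (fun (c : C) (x : A × B) => (x, c)))
  obtain ⟨V', s', hV', hs', h4, e4⟩ := psd_diag _ hB
  have := ssa_psd ρ U hU p hp h1 V hV s hs h2 U' hU' p' hp' h3 V' hV' s' hs' h4
  rw [e1, e2, e3, e4]
  linarith
end SSA

lemma vnEntropy_reindex {m n : Type*} [Fintype n] [DecidableEq n] [Fintype m] [DecidableEq m]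
    (e : m ≃ n) (M : Matrix n n ℂ) : vnEntropy (M.submatrix e e) = vnEntropy M := by
  by_cases h : M.IsHermitian
  · have h' : (M.submatrix e e).IsHermitian := h.submatrix e
    rw [vnEntropy, vnEntropy, dif_pos h, dif_pos h']
    have hc : (M.submatrix e e).charpoly = M.charpoly := by
      have := Matrix.charpoly_reindex e.symm M
      simpa using this
    have h1 := h'.roots_charpoly_eq_eigenvalues
    rw [hc, h.roots_charpoly_eq_eigenvalues] at h1
    have h2 := congrArg (fun s => (s.map (fun z : ℂ => z.re * Real.log z.re)).sum) h1
    simp only [Multiset.map_map, Function.comp_def] at h2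
    exact neg_inj.mpr h2.symm
  · have h' : ¬ (M.submatrix e e).IsHermitian := fun h' => h (by
      have := h'.submatrix e.symm
      simpa using this)
    rw [vnEntropy, vnEntropy, dif_neg h, dif_neg h']

lemma marg_reindex {n : ℕ} {d : Fin n → ℕ} {K Z : Type*} [Fintype K] [Fintype Z] [DecidableEq K]
    [Nonempty K] [Nonempty Z]
    (S : Finset (Fin n)) (σ : Matrix (∀ i, Fin (d i)) (∀ i, Fin (d i)) ℂ)
    (e : K × Z ≃ ∀ i, Fin (d i))
    (h1 : ∀ x z z' i, i ∈ S → e (x, z) i = e (x, z') i)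
    (h2 : ∀ x x' z i, i ∉ S → e (x, z) i = e (x', z) i) :
    vnEntropy (marg S σ)
      = vnEntropy (Matrix.of fun x y => ∑ z, σ (e (x, z)) (e (y, z)) : Matrix K K ℂ) := by
  obtain ⟨x0⟩ := ‹Nonempty K›
  obtain ⟨z0⟩ := ‹Nonempty Z›
  let k : K → (∀ i : {j // j ∈ S}, Fin (d i.1)) := fun x i => e (x, z0) i.1
  let f : Z → (∀ i : {j // j ∉ S}, Fin (d i.1)) := fun z i => e (x0, z) i.1
  have hglue : ∀ x z, (fun i => if h : i ∈ S then k x ⟨i, h⟩ else f z ⟨i, h⟩) = e (x, z) := by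
    intro x z
    funext i
    by_cases h : i ∈ S
    · simp only [h, dif_pos, k]; exact h1 _ _ _ _ h
    · simp only [h, dif_neg, f, not_false_eq_true]; exact h2 _ _ _ _ h
  have hk : Function.Bijective k := by
    constructor
    · intro x y hxy
      have := hglue x z0
      rw [hxy, hglue] at this
      exact (Prod.ext_iff.mp (e.injective this)).1.symm
    · intro u
      obtain ⟨⟨x, z⟩, hx⟩ := e.surjective (fun i => if h : i ∈ S then u ⟨i, h⟩ else f z0 ⟨i, h⟩)
      refine ⟨x, funext fun i => ?_⟩
      have := congrFun hx i.1
      simp only [i.2, dif_pos] at this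
      simp only [k]
      rw [h1 x z0 z _ i.2, this]
  have hf : Function.Bijective f := by
    constructor
    · intro x y hxy
      have := hglue x0 x
      rw [hxy, hglue] at this
      exact (Prod.ext_iff.mp (e.injective this)).2.symm
    · intro u
      obtain ⟨⟨x, z⟩, hx⟩ := e.surjective (fun i => if h : i ∈ S then k x0 ⟨i, h⟩ else u ⟨i, h⟩)
      refine ⟨z, funext fun i => ?_⟩
      have := congrFun hx i.1
      simp only [i.2, dif_neg, not_false_eq_true] at this
      simp only [f]
      rw [h2 x0 x z _ i.2, this]
  rw [← vnEntropy_reindex (Equiv.ofBijective k hk)]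
  congr 1
  ext x y
  simp only [Matrix.submatrix_apply, Equiv.ofBijective_apply, Matrix.of_apply, marg]
  rw [← Equiv.sum_comp (Equiv.ofBijective f hf)]
  simp only [Equiv.ofBijective_apply, hglue]

set_option maxHeartbeats 2000000 in
/-- Strong subadditivity for marginals. -/
lemma qcmi_nonneg {n : ℕ} {d : Fin n → ℕ}
    (σ : Matrix (∀ i, Fin (d i)) (∀ i, Fin (d i)) ℂ) (hσ : IsDensity σ)
    (U W S : Finset (Fin n)) (hUW : Disjoint U W) (hUS : Disjoint U S) (hWS : Disjoint W S) :
    0 ≤ qcmiSets U W S σ := by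
  have hne : Nonempty (∀ i, Fin (d i)) := by
    by_contra h
    rw [not_nonempty_iff] at h
    have := hσ.2
    simp [Matrix.trace] at this
  obtain ⟨x0⟩ := hne
  let A := ∀ i : {j // j ∈ U}, Fin (d i.1)
  let B := ∀ i : {j : {j // j ∉ U} // j.1 ∈ S}, Fin (d i.1.1)
  let C := ∀ i : {j : {j : {j // j ∉ U} // j.1 ∉ S} // j.1.1 ∈ W}, Fin (d i.1.1.1)
  let R := ∀ i : {j : {j : {j // j ∉ U} // j.1 ∉ S} // j.1.1 ∉ W}, Fin (d i.1.1.1)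
  let e : A × B × C × R ≃ ∀ i, Fin (d i) :=
    ((Equiv.piEquivPiSubtypeProd (fun j => j ∈ U) (fun i => Fin (d i))).trans
      (Equiv.prodCongr (Equiv.refl _)
        ((Equiv.piEquivPiSubtypeProd (fun j : {j // j ∉ U} => j.1 ∈ S)
            (fun i => Fin (d i.1))).trans
          (Equiv.prodCongr (Equiv.refl _)
            (Equiv.piEquivPiSubtypeProd (fun j : {j : {j // j ∉ U} // j.1 ∉ S} => j.1.1 ∈ W)
              (fun i => Fin (d i.1.1))))))).symm
  have he : ∀ a b c r i, e (a, b, c, r) i =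
      if hU : i ∈ U then a ⟨i, hU⟩ else if hS : i ∈ S then b ⟨⟨i, hU⟩, hS⟩ else
        if hW : i ∈ W then c ⟨⟨⟨i, hU⟩, hS⟩, hW⟩ else r ⟨⟨⟨i, hU⟩, hS⟩, hW⟩ := by
    intro a b c r i
    rfl
  have : Nonempty A := ⟨fun i => x0 _⟩
  have : Nonempty B := ⟨fun i => x0 _⟩
  have : Nonempty C := ⟨fun i => x0 _⟩
  have : Nonempty R := ⟨fun i => x0 _⟩
  let ρ : Matrix ((A × B) × C) ((A × B) × C) ℂ :=
    Matrix.of fun x y => ∑ r, σ (e (x.1.1, x.1.2, x.2, r)) (e (y.1.1, y.1.2, y.2, r))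
  have hρ : ρ.PosSemidef :=
    psd_sum σ hσ.1 (fun (r : R) (x : (A × B) × C) => e (x.1.1, x.1.2, x.2, r))
  have key := ssa_entropy ρ hρ
  have dUW : ∀ i, i ∈ U → i ∉ W := fun i hi => Finset.disjoint_left.mp hUW hi
  have dUS : ∀ i, i ∈ U → i ∉ S := fun i hi => Finset.disjoint_left.mp hUS hi
  have dWS : ∀ i, i ∈ W → i ∉ S := fun i hi => Finset.disjoint_left.mp hWS hi
  let e4 : ((A × B) × C) × R ≃ A × B × C × R :=
    ⟨fun x => (x.1.1.1, x.1.1.2, x.1.2, x.2), fun x => (((x.1, x.2.1), x.2.2.1), x.2.2.2),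
      fun _ => rfl, fun _ => rfl⟩
  let e3 : (A × B) × (C × R) ≃ A × B × C × R :=
    ⟨fun x => (x.1.1, x.1.2, x.2.1, x.2.2), fun x => ((x.1, x.2.1), (x.2.2.1, x.2.2.2)),
      fun _ => rfl, fun _ => rfl⟩
  let e2 : (B × C) × (A × R) ≃ A × B × C × R :=
    ⟨fun x => (x.2.1, x.1.1, x.1.2, x.2.2), fun x => ((x.2.1, x.2.2.1), (x.1, x.2.2.2)),
      fun _ => rfl, fun _ => rfl⟩
  let e1 : B × (A × C × R) ≃ A × B × C × R :=
    ⟨fun x => (x.2.1, x.1, x.2.2.1, x.2.2.2), fun x => (x.2.1, (x.1, x.2.2.1, x.2.2.2)),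
      fun _ => rfl, fun _ => rfl⟩
  have f4 : vnEntropy (marg (U ∪ W ∪ S) σ) = vnEntropy ρ := by
    rw [marg_reindex (U ∪ W ∪ S) σ (e4.trans e)]
    · rfl
    · rintro ⟨⟨a, b⟩, c⟩ r r' i hi
      simp only [Equiv.trans_apply, e4, Equiv.coe_fn_mk, he]
      simp only [Finset.mem_union] at hi
      split_ifs <;> first | rfl | (exfalso; tauto)
    · rintro ⟨⟨a, b⟩, c⟩ ⟨⟨a', b'⟩, c'⟩ r i hi
      simp only [Equiv.trans_apply, e4, Equiv.coe_fn_mk, he]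
      simp only [Finset.mem_union, not_or] at hi
      split_ifs <;> first | rfl | (exfalso; tauto)
  have f3 : vnEntropy (marg (U ∪ S) σ) = vnEntropy
      (Matrix.of fun x y => ∑ c, ρ (x, c) (y, c) : Matrix (A × B) (A × B) ℂ) := by
    rw [marg_reindex (U ∪ S) σ (e3.trans e)]
    · simp only [Fintype.sum_prod_type]
      rfl
    · rintro ⟨a, b⟩ ⟨c, r⟩ ⟨c', r'⟩ i hi
      simp only [Equiv.trans_apply, e3, Equiv.coe_fn_mk, he]
      simp only [Finset.mem_union] at hi
      split_ifs <;> first | rfl | (exfalso; tauto)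
    · rintro ⟨a, b⟩ ⟨a', b'⟩ ⟨c, r⟩ i hi
      simp only [Equiv.trans_apply, e3, Equiv.coe_fn_mk, he]
      simp only [Finset.mem_union, not_or] at hi
      split_ifs <;> first | rfl | (exfalso; tauto)
  have f2 : vnEntropy (marg (W ∪ S) σ) = vnEntropy
      (Matrix.of fun x y => ∑ a, ρ ((a, x.1), x.2) ((a, y.1), y.2) :
        Matrix (B × C) (B × C) ℂ) := by
    rw [marg_reindex (W ∪ S) σ (e2.trans e)]
    · simp only [Fintype.sum_prod_type]
      rfl
    · rintro ⟨b, c⟩ ⟨a, r⟩ ⟨a', r'⟩ i hi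
      simp only [Equiv.trans_apply, e2, Equiv.coe_fn_mk, he]
      simp only [Finset.mem_union] at hi
      have := dUW i; have := dUS i
      split_ifs <;> first | rfl | (exfalso; tauto)
    · rintro ⟨b, c⟩ ⟨b', c'⟩ ⟨a, r⟩ i hi
      simp only [Equiv.trans_apply, e2, Equiv.coe_fn_mk, he]
      simp only [Finset.mem_union, not_or] at hi
      split_ifs <;> first | rfl | (exfalso; tauto)
  have f1 : vnEntropy (marg S σ) = vnEntropy
      (Matrix.of fun x y => ∑ a, ∑ c, ρ ((a, x), c) ((a, y), c) : Matrix B B ℂ) := by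
    rw [marg_reindex S σ (e1.trans e)]
    · simp only [Fintype.sum_prod_type]
      rfl
    · rintro b ⟨a, c, r⟩ ⟨a', c', r'⟩ i hi
      simp only [Equiv.trans_apply, e1, Equiv.coe_fn_mk, he]
      have := dUS i
      split_ifs <;> first | rfl | (exfalso; tauto)
    · rintro b b' ⟨a, c, r⟩ i hi
      simp only [Equiv.trans_apply, e1, Equiv.coe_fn_mk, he]
      split_ifs
      all_goals rfl
  have key2 : vnEntropy (marg (U ∪ W ∪ S) σ) + vnEntropy (marg S σ) ≤
      vnEntropy (marg (U ∪ S) σ) + vnEntropy (marg (W ∪ S) σ) := by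
    rw [f1, f2, f3, f4]
    convert key
  rw [qcmiSets]
  linarith

lemma marg_univ {n : ℕ} {d : Fin n → ℕ}
    (σ : Matrix (∀ i, Fin (d i)) (∀ i, Fin (d i)) ℂ) (hσ : IsDensity σ) :
    vnEntropy (marg Finset.univ σ) = vnEntropy σ := by
  have hne : Nonempty (∀ i, Fin (d i)) := by
    by_contra h
    rw [not_nonempty_iff] at h
    have := hσ.2
    simp [Matrix.trace] at this
  rw [marg_reindex Finset.univ σ (Equiv.prodPUnit.{0} _)]
  · congr 1
    ext x y
    simp
  · intros; rfl
  · intro x x' z i hi; simp at hi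

/-- Double counting of degrees. -/
lemma degree_sum {n : ℕ} (G : SimpleGraph (Fin n)) [DecidableRel G.Adj] (h : Fin n → ℝ) :
    ∑ i, (G.degree i : ℝ) * h i = ∑ p ∈ edgePairs G, (h p.1 + h p.2) := by
  have h1 : ∀ i, (G.degree i : ℝ) * h i = ∑ j, if G.Adj i j then h i else 0 := by
    intro i
    rw [← Finset.sum_filter, Finset.sum_const, nsmul_eq_mul, ← SimpleGraph.card_neighborFinset_eq_degree,
      SimpleGraph.neighborFinset_eq_filter]
  simp only [h1]
  rw [edgePairs, Finset.sum_filter, Fintype.sum_prod_type]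
  have h2 : ∀ i j, (if G.Adj i j then h i else 0) =
      (if i < j ∧ G.Adj i j then h i else 0) + (if j < i ∧ G.Adj j i then h i else 0) := by
    intro i j
    rcases lt_trichotomy i j with hl | rfl | hl
    · simp [hl, hl.not_gt, G.adj_comm j i]
    · simp
    · simp [hl, hl.not_gt, G.adj_comm j i]
  simp only [h2, Finset.sum_add_distrib]
  rw [Finset.sum_comm (f := fun i j => if j < i ∧ G.Adj j i then h i else 0)]
  simp only [← Finset.sum_add_distrib]
  refine Finset.sum_congr rfl fun i _ => Finset.sum_congr rfl fun j _ => ?_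
  split_ifs <;> simp

lemma card_edgePairs {n : ℕ} (G : SimpleGraph (Fin n)) [DecidableRel G.Adj] (hT : G.IsTree) :
    (edgePairs G).card + 1 = n := by
  have h1 := hT.card_edgeFinset
  rw [Fintype.card_fin] at h1
  have h2 := degree_sum G (fun _ => 1)
  have h3 := G.sum_degrees_eq_twice_card_edges
  have h4 : ((∑ v, G.degree v : ℕ) : ℝ) = ((2 * G.edgeFinset.card : ℕ) : ℝ) := by rw [h3]
  simp only [mul_one, Finset.sum_const, nsmul_eq_mul] at h2
  push_cast at h4
  rw [h2] at h4
  have h5 : ((edgePairs G).card : ℝ) = G.edgeFinset.card := by linarith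
  have h6 : (edgePairs G).card = G.edgeFinset.card := by exact_mod_cast h5
  omega

/-- Building up a tree by adding leaves (the reverse of iterated leaf removal). -/
lemma grow {n : ℕ} (G : SimpleGraph (Fin n)) [DecidableRel G.Adj] (hG : G.Connected)
    (h : Finset (Fin n) → ℝ) (k : ℕ) (hk : k + 1 ≤ n) :
    ∃ (A : Finset (Fin n)) (F : Finset (Fin n × Fin n))
      (L : List (Finset (Fin n) × Finset (Fin n) × Finset (Fin n))),
      A.card = k + 1 ∧ F.card = k ∧ F ⊆ edgePairs G ∧ (∀ p ∈ F, p.1 ∈ A ∧ p.2 ∈ A) ∧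
      (∀ t ∈ L, Disjoint t.1 t.2.1 ∧ Disjoint t.1 t.2.2 ∧ Disjoint t.2.1 t.2.2) ∧
      ∑ p ∈ F, (h {p.1, p.2} - h {p.1} - h {p.2}) + ∑ i ∈ A, h {i} - h A
        = (L.map (fun t => h (t.1 ∪ t.2.2) + h (t.2.1 ∪ t.2.2) - h t.2.2
            - h (t.1 ∪ t.2.1 ∪ t.2.2))).sum := by
  induction k with
  | zero =>
    refine ⟨{⟨0, by omega⟩}, ∅, [], by simp, by simp, by simp, by simp, by simp, by simp⟩
  | succ k ih =>
    obtain ⟨A, F, L, hA, hF, hFG, hFA, hL, hsum⟩ := ih (by omega)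
    have hex : ∃ x ∈ A, ∃ y, y ∉ A ∧ G.Adj x y := by
      by_contra hcon
      push Not at hcon
      have hne : A.Nonempty := Finset.card_pos.mp (by omega)
      obtain ⟨x, hx⟩ := hne
      have hall : ∀ y, y ∈ A := by
        intro y
        obtain ⟨w⟩ := hG.preconnected x y
        induction w with
        | nil => exact hx
        | cons hadj _ ih =>
          refine ih ?_
          by_contra hv
          exact hcon _ hx _ hv hadj
      have : A = Finset.univ := Finset.eq_univ_iff_forall.mpr hall
      rw [this, Finset.card_univ, Fintype.card_fin] at hA
      omega
    obtain ⟨x, hx, y, hy, hxy⟩ := hex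
    have hne : x ≠ y := hxy.ne
    obtain ⟨q, hq, hqE, hqh⟩ : ∃ q : Fin n × Fin n, (q = (x, y) ∨ q = (y, x)) ∧ q ∈ edgePairs G ∧
        h {q.1, q.2} - h {q.1} - h {q.2} = h {y, x} - h {x} - h {y} := by
      rcases lt_or_gt_of_ne hne with hl | hl
      · exact ⟨(x, y), Or.inl rfl, by simp [edgePairs, hl, hxy], by
          rw [Finset.pair_comm]⟩
      · exact ⟨(y, x), Or.inr rfl, by simp [edgePairs, hl, hxy.symm], by ring⟩
    have hqF : q ∉ F := by
      intro hmem
      have := hFA q hmem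
      rcases hq with rfl | rfl
      · exact hy this.2
      · exact hy this.1
    refine ⟨insert y A, insert q F, ({y}, A \ {x}, {x}) :: L, ?_, ?_, ?_, ?_, ?_, ?_⟩
    · rw [Finset.card_insert_of_notMem hy, hA]
    · rw [Finset.card_insert_of_notMem hqF, hF]
    · exact Finset.insert_subset hqE hFG
    · intro p hp
      rw [Finset.mem_insert] at hp
      rcases hp with rfl | hp
      · rcases hq with rfl | rfl <;> simp [hx]
      · have := hFA p hp
        simp [this]
    · intro t ht
      rw [List.mem_cons] at ht
      rcases ht with rfl | ht
      · refine ⟨?_, ?_, ?_⟩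
        · simp [hy]
        · simpa using hne.symm
        · simp
      · exact hL t ht
    · rw [Finset.sum_insert hqF, Finset.sum_insert hy, List.map_cons, List.sum_cons, ← hsum, hqh]
      have s1 : A \ {x} ∪ {x} = A := Finset.sdiff_union_of_subset (by simpa using hx)
      have s2 : ({y} : Finset (Fin n)) ∪ {x} = {y, x} := by ext; simp
      have s3 : {y} ∪ A \ {x} ∪ {x} = insert y A := by
        rw [Finset.union_assoc, s1]; ext; simp
      simp only [s1, s2, s3]
      ring

/-- For any density operator `σ` on a multipartite space and any tree `T`,
the quantity `∑_{{i,j}∈E} S(σ_{ij}) − ∑_i (deg(i) − 1) S(σ_i) − S(σ)` is nonnegative; indeed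
it equals a finite sum of quantum conditional mutual informations of `σ` (between disjoint
groups of sites), each of which is nonnegative by strong subadditivity. -/
theorem tree_entropy_defect_nonneg {n : ℕ} {d : Fin n → ℕ}
    (G : SimpleGraph (Fin n)) [DecidableRel G.Adj] (hT : G.IsTree)
    (σ : Matrix (∀ i, Fin (d i)) (∀ i, Fin (d i)) ℂ) (hσ : IsDensity σ) :
    0 ≤ (∑ p ∈ edgePairs G, vnEntropy (marg {p.1, p.2} σ))
        - (∑ i, ((G.degree i : ℝ) - 1) * vnEntropy (marg {i} σ)) - vnEntropy σ ∧
    ∃ (m : ℕ) (U W S : Fin m → Finset (Fin n)),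
      (∀ k, Disjoint (U k) (W k) ∧ Disjoint (U k) (S k) ∧ Disjoint (W k) (S k)) ∧
      (∀ k, 0 ≤ qcmiSets (U k) (W k) (S k) σ) ∧
      (∑ p ∈ edgePairs G, vnEntropy (marg {p.1, p.2} σ))
          - (∑ i, ((G.degree i : ℝ) - 1) * vnEntropy (marg {i} σ)) - vnEntropy σ
        = ∑ k, qcmiSets (U k) (W k) (S k) σ := by
  have hn := card_edgePairs G hT
  obtain ⟨A, F, L, hA, hF, hFG, -, hL, hsum⟩ :=
    grow G hT.connected (fun S => vnEntropy (marg S σ)) (edgePairs G).card (by omega)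
  have hAu : A = Finset.univ := by
    rw [← Finset.card_eq_iff_eq_univ, Fintype.card_fin]; omega
  have hFE : F = edgePairs G := Finset.eq_of_subset_of_card_le hFG (by omega)
  subst hAu hFE
  have hE : (∑ p ∈ edgePairs G, vnEntropy (marg {p.1, p.2} σ))
          - (∑ i, ((G.degree i : ℝ) - 1) * vnEntropy (marg {i} σ)) - vnEntropy σ
        = ∑ k : Fin L.length, qcmiSets (L.get k).1 (L.get k).2.1 (L.get k).2.2 σ := by
    have hl : ∑ k : Fin L.length, qcmiSets (L.get k).1 (L.get k).2.1 (L.get k).2.2 σ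
        = (L.map (fun t => qcmiSets t.1 t.2.1 t.2.2 σ)).sum := by
      rw [← List.sum_ofFn]
      congr 1
      conv_rhs => rw [← List.ofFn_get L, List.map_ofFn]
      rfl
    rw [hl]
    refine Eq.trans ?_ hsum
    simp only [sub_mul, one_mul, Finset.sum_sub_distrib, degree_sum, Finset.sum_add_distrib,
      marg_univ σ hσ]
    ring
  have hnn : ∀ k : Fin L.length, 0 ≤ qcmiSets (L.get k).1 (L.get k).2.1 (L.get k).2.2 σ := by
    intro k
    obtain ⟨h1, h2, h3⟩ := hL (L.get k) (List.get_mem L k)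
    exact qcmi_nonneg σ hσ _ _ _ h1 h2 h3
  refine ⟨?_, L.length, fun k => (L.get k).1, fun k => (L.get k).2.1, fun k => (L.get k).2.2,
    fun k => hL (L.get k) (List.get_mem L k), hnn, hE⟩
  rw [hE]
  exact Finset.sum_nonneg fun k _ => hnn k
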